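/- arXiv:2401.16836 — 6 statements merged into one kernel-verified Lean document; each statement's English description precedes it below -/
import Mathlib

section
/- Let A ∈ ℝ_+^{m×n×p} be a nonnegative third-order tensor and let 1 ≤ r1 ≤ m, 1 ≤ r2 ≤ n. Then A is co-(r1,r2)-separable if and only if there exist permutation tensors Π1 ∈ ℝ^{m×m×p} and Π2 ∈ ℝ^{n×n×p} and nonnegative tensors S ∈ ℝ_+^{r1×r2×p}, M ∈ ℝ_+^{(m−r1)×r1×p}, H ∈ ℝ_+^{r2×(n−r2)×p} such that A = Π1 * [[S, S*H],[M*S, M*S*H]] * Π2. -/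
open Matrix BigOperators Kronecker

namespace CoSepNTF

noncomputable section

variable {p : ℕ}

/-- The t-product of third-order tensors, represented by their `Fin p`-indexed frontal
slices: `(A * B)_{::s} = ∑ t, A_{::(s-t mod p)} ⬝ B_{::t}`, which is exactly
`fold (bcirc A ⬝ unfold B)`. -/
def tprod {α β γ : Type*} [Fintype β] (A : Fin p → Matrix α β ℝ)
    (B : Fin p → Matrix β γ ℝ) : Fin p → Matrix α γ ℝ :=
  fun s => ∑ t : Fin p, A (s - t) * B t

/-- The identity tensor: first frontal slice the identity, other slices zero. -/
def tId (n p : ℕ) [NeZero p] : Fin p → Matrix (Fin n) (Fin n) ℝ :=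
  fun k => if k = 0 then 1 else 0

/-- Tensor transpose: `(Aᵀ)_{::k} = (A_{::(p-k+2)})ᵀ` (1-based), i.e. slice `-k` (0-based). -/
def tT {α β : Type*} [NeZero p] (A : Fin p → Matrix α β ℝ) : Fin p → Matrix β α ℝ :=
  fun k => (A (-k))ᵀ

/-- A tensor is nonnegative if all its entries are nonnegative. -/
def Nonneg {α β : Type*} (A : Fin p → Matrix α β ℝ) : Prop := ∀ k i j, 0 ≤ A k i j

/-- Horizontal subtensor `A_{I::}` given by a row-selection map `ι`. -/
def rsub {α α' β : Type*} (ι : α' → α) (A : Fin p → Matrix α β ℝ) : Fin p → Matrix α' β ℝ :=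
  fun k => (A k).submatrix ι id

/-- Lateral subtensor `A_{:J:}` given by a column-selection map `κ`. -/
def csub {α β β' : Type*} (κ : β' → β) (A : Fin p → Matrix α β ℝ) : Fin p → Matrix α β' ℝ :=
  fun k => (A k).submatrix id κ

/-- Subtensor `A_{IJ:}`. -/
def coreSub {α α' β β' : Type*} (ι : α' → α) (κ : β' → β) (A : Fin p → Matrix α β ℝ) :
    Fin p → Matrix α' β' ℝ := fun k => (A k).submatrix ι κ

/-- `A` is co-(r1,r2)-separable with core `A_{IJ:}` for the index sets given by `ι, κ`. -/
def CoseparableWithCore {m n r1 r2 : ℕ} [NeZero p] (ι : Fin r1 → Fin m) (κ : Fin r2 → Fin n)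
    (A : Fin p → Matrix (Fin m) (Fin n) ℝ) : Prop :=
  ∃ (P1 : Fin p → Matrix (Fin m) (Fin r1) ℝ) (P2 : Fin p → Matrix (Fin r2) (Fin n) ℝ),
    Nonneg P1 ∧ Nonneg P2 ∧ rsub ι P1 = tId r1 p ∧ csub κ P2 = tId r2 p ∧
    A = tprod (tprod P1 (coreSub ι κ A)) P2

/-- `A` is co-(r1,r2)-separable. -/
def Coseparable {m n : ℕ} [NeZero p] (r1 r2 : ℕ) (A : Fin p → Matrix (Fin m) (Fin n) ℝ) : Prop :=
  ∃ (ι : Fin r1 → Fin m) (κ : Fin r2 → Fin n),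
    Function.Injective ι ∧ Function.Injective κ ∧ CoseparableWithCore ι κ A

/-- A permutation tensor: first frontal slice a permutation matrix, other slices zero. -/
def IsPermTensor {n : ℕ} [NeZero p] (Q : Fin p → Matrix (Fin n) (Fin n) ℝ) : Prop :=
  (∃ σ : Equiv.Perm (Fin n), Q 0 = σ.permMatrix ℝ) ∧ ∀ k, k ≠ 0 → Q k = 0

/-- 2×2 block tensor `[[A11, A12],[A21, A22]]` of size `m × n × p` (where `r1 ≤ m`, `r2 ≤ n`),
formed by block concatenation of each frontal slice. -/
def blockT {m n r1 r2 : ℕ} (hm : r1 ≤ m) (hn : r2 ≤ n)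
    (A11 : Fin p → Matrix (Fin r1) (Fin r2) ℝ)
    (A12 : Fin p → Matrix (Fin r1) (Fin (n - r2)) ℝ)
    (A21 : Fin p → Matrix (Fin (m - r1)) (Fin r2) ℝ)
    (A22 : Fin p → Matrix (Fin (m - r1)) (Fin (n - r2)) ℝ) :
    Fin p → Matrix (Fin m) (Fin n) ℝ :=
  fun k => (Matrix.fromBlocks (A11 k) (A12 k) (A21 k) (A22 k)).submatrix
    (fun i => finSumFinEquiv.symm (Fin.cast (Nat.add_sub_cancel' hm).symm i))
    (fun j => finSumFinEquiv.symm (Fin.cast (Nat.add_sub_cancel' hn).symm j))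

/-- The block circulant matrix of a tensor: block `(s,t)` is `A_{::((s-t) mod p)}`. -/
def bcirc {α β : Type*} (A : Fin p → Matrix α β ℝ) : Matrix (Fin p × α) (Fin p × β) ℝ :=
  Matrix.of fun si tj => A (si.1 - tj.1) si.2 tj.2

/-- The unfolding of a tensor into a block-column matrix. -/
def unfoldT {α β : Type*} (A : Fin p → Matrix α β ℝ) : Matrix (Fin p × α) β ℝ :=
  Matrix.of fun ki j => A ki.1 ki.2 j

/-- Squared Frobenius norm of a real tensor. -/
def frobSq {α β : Type*} [Fintype α] [Fintype β] (A : Fin p → Matrix α β ℝ) : ℝ :=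
  ∑ k, ∑ i, ∑ j, (A k i j) ^ 2

/-- Squared Frobenius norm of a complex tensor. -/
def frobSqC {α β : Type*} [Fintype α] [Fintype β] (A : Fin p → Matrix α β ℂ) : ℝ :=
  ∑ k, ∑ i, ∑ j, ‖A k i j‖ ^ 2

/-- Squared Frobenius norm of a real matrix. -/
def matFrobSq {α β : Type*} [Fintype α] [Fintype β] (M : Matrix α β ℝ) : ℝ :=
  ∑ i, ∑ j, (M i j) ^ 2

/-- The discrete Fourier transform of a tensor along the third dimension:
`Â_{::k} = ∑ j, ω_p^(jk) A_{::j}` with `ω_p = exp(-2πi/p)`. -/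
def fft {α β : Type*} (A : Fin p → Matrix α β ℝ) : Fin p → Matrix α β ℂ :=
  fun k => ∑ j : Fin p,
    (Complex.exp (-2 * (Real.pi : ℂ) * Complex.I / (p : ℂ)) ^ ((j : ℕ) * (k : ℕ))) •
      (A j).map Complex.ofReal

/-- The spectral (ℓ²-operator) norm of a complex matrix. -/
def specNorm {α β : Type*} [Fintype α] [Fintype β] [DecidableEq β] (M : Matrix α β ℂ) : ℝ :=
  ‖LinearMap.toContinuousLinearMap (Matrix.toEuclideanLin M)‖

/-- The tensor spectral norm: `‖A‖₂ = max_k ‖Â_{::k}‖₂`. -/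
def tSpecNorm {α β : Type*} [Fintype α] [Fintype β] [DecidableEq β]
    (A : Fin p → Matrix α β ℝ) : ℝ :=
  ⨆ k, specNorm (fft A k)

/-- The unitary DFT matrix `F_p = (1/√p)(ω_p^{jk})`. -/
def dftMatrix (p : ℕ) : Matrix (Fin p) (Fin p) ℂ :=
  Matrix.of fun j k =>
    (((Real.sqrt p)⁻¹ : ℝ) : ℂ) *
      Complex.exp (-2 * (Real.pi : ℂ) * Complex.I / (p : ℂ)) ^ ((j : ℕ) * (k : ℕ))

/-- The block diagonal matrix `diag(Â_{::1}, …, Â_{::p})`. -/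
def fftBD {α β : Type*} (A : Fin p → Matrix α β ℝ) : Matrix (Fin p × α) (Fin p × β) ℂ :=
  Matrix.of fun ki lj => if ki.1 = lj.1 then fft A ki.1 ki.2 lj.2 else 0

/-- The square of the smallest nonzero singular value of `M`, i.e. the smallest nonzero
eigenvalue of `Mᴴ * M`. -/
def sigmaMinSq {α β : Type*} [Fintype α] [Fintype β] (M : Matrix α β ℂ) : ℝ :=
  sInf {t : ℝ | t ≠ 0 ∧ ∃ v : β → ℂ, v ≠ 0 ∧ (Mᴴ * M) *ᵥ v = (t : ℂ) • v}


/-- Left multiplication by a tensor supported on its first frontal slice acts slicewise. -/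
lemma tprod_of_left_supported {α β γ : Type*} [Fintype β] [NeZero p] (Q : Fin p → Matrix α β ℝ)
    (hQ : ∀ k, k ≠ 0 → Q k = 0) (B : Fin p → Matrix β γ ℝ) :
    tprod Q B = fun k => Q 0 * B k := by
  funext s
  rw [tprod, Finset.sum_eq_single s]
  · rw [sub_self]
  · intro t _ ht
    rw [hQ _ (sub_ne_zero.mpr ht.symm), Matrix.zero_mul]
  · simp

/-- Right multiplication by a tensor supported on its first frontal slice acts slicewise. -/
lemma tprod_of_right_supported {α β γ : Type*} [Fintype β] [NeZero p] (A : Fin p → Matrix α β ℝ)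
    (Q : Fin p → Matrix β γ ℝ) (hQ : ∀ k, k ≠ 0 → Q k = 0) :
    tprod A Q = fun k => A k * Q 0 := by
  funext s
  rw [tprod, Finset.sum_eq_single 0]
  · rw [sub_zero]
  · intro t _ ht
    rw [hQ _ ht, Matrix.mul_zero]
  · simp

lemma tId_tprod {γ : Type*} {n : ℕ} [NeZero p] (B : Fin p → Matrix (Fin n) γ ℝ) :
    tprod (tId n p) B = B := by
  rw [tprod_of_left_supported (tId n p) (fun k hk => if_neg hk)]
  simp [tId]

lemma tprod_tId {α : Type*} {n : ℕ} [NeZero p] (A : Fin p → Matrix α (Fin n) ℝ) :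
    tprod A (tId n p) = A := by
  rw [tprod_of_right_supported A (tId n p) (fun k hk => if_neg hk)]
  simp [tId]

lemma coreSub_tprod {α α' β γ γ' : Type*} [Fintype β] (ι : α' → α) (κ : γ' → γ)
    (A : Fin p → Matrix α β ℝ) (B : Fin p → Matrix β γ ℝ) :
    coreSub ι κ (tprod A B) = tprod (rsub ι A) (csub κ B) := by
  funext k
  ext i j
  simp [coreSub, tprod, rsub, csub, Matrix.sum_apply, Matrix.mul_apply]

lemma rsub_tprod {α α' β γ : Type*} [Fintype β] (ι : α' → α)
    (A : Fin p → Matrix α β ℝ) (B : Fin p → Matrix β γ ℝ) :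
    rsub ι (tprod A B) = tprod (rsub ι A) B :=
  coreSub_tprod ι id A B

lemma tId_nonneg (n p : ℕ) [NeZero p] : Nonneg (tId n p) := by
  intro k i j
  by_cases hk : k = 0
  · by_cases hij : i = j <;> simp [tId, hk, hij, Matrix.one_apply]
  · simp [tId, hk]

/-- The permutation tensor of a permutation of the index set. -/
def permT {n : ℕ} (p : ℕ) [NeZero p] (σ : Equiv.Perm (Fin n)) :
    Fin p → Matrix (Fin n) (Fin n) ℝ :=
  fun k => if k = 0 then σ.permMatrix ℝ else 0

lemma isPermTensor_permT {n : ℕ} [NeZero p] (σ : Equiv.Perm (Fin n)) :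
    IsPermTensor (permT p σ) :=
  ⟨⟨σ, if_pos rfl⟩, fun _ hk => if_neg hk⟩

lemma IsPermTensor.exists_eq_permT {n : ℕ} [NeZero p] {Q : Fin p → Matrix (Fin n) (Fin n) ℝ}
    (hQ : IsPermTensor Q) : ∃ σ, Q = permT p σ := by
  obtain ⟨⟨σ, hσ⟩, h0⟩ := hQ
  refine ⟨σ, funext fun k => ?_⟩
  by_cases hk : k = 0
  · simp [permT, hk, hσ]
  · simp [permT, hk, h0 k hk]

lemma permT_tprod_tprod_permT {m n : ℕ} [NeZero p] (σ : Equiv.Perm (Fin m))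
    (τ : Equiv.Perm (Fin n)) (B : Fin p → Matrix (Fin m) (Fin n) ℝ) :
    tprod (tprod (permT p σ) B) (permT p τ) = coreSub σ τ.symm B := by
  rw [tprod_of_right_supported _ (permT p τ) (fun k hk => if_neg hk),
    tprod_of_left_supported (permT p σ) (fun k hk => if_neg hk)]
  funext k
  simp only [permT, if_true, Equiv.Perm.permMatrix, PEquiv.toMatrix_toPEquiv_mul,
    PEquiv.mul_toMatrix_toPEquiv, coreSub]
  rfl

/-- The splitting of an index set of size `m` into its first `r` and last `m - r` elements. -/
def splitEquiv {m r : ℕ} (h : r ≤ m) : Fin m ≃ Fin r ⊕ Fin (m - r) :=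
  (finCongr (Nat.add_sub_cancel' h).symm).trans finSumFinEquiv.symm

/-- The vertical concatenation of the identity tensor and `M`. -/
def idRows {β : Type*} {r : ℕ} [NeZero p] (M : Fin p → Matrix β (Fin r) ℝ) :
    Fin p → Matrix (Fin r ⊕ β) (Fin r) ℝ :=
  fun k => Matrix.fromRows (tId r p k) (M k)

/-- The horizontal concatenation of the identity tensor and `H`. -/
def idCols {β : Type*} {r : ℕ} [NeZero p] (H : Fin p → Matrix (Fin r) β ℝ) :
    Fin p → Matrix (Fin r) (Fin r ⊕ β) ℝ :=
  fun k => Matrix.fromCols (tId r p k) (H k)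

lemma Nonneg.idRows {β : Type*} {r : ℕ} [NeZero p] {M : Fin p → Matrix β (Fin r) ℝ}
    (hM : Nonneg M) : Nonneg (idRows M) := by
  rintro k (i | i) j
  · exact tId_nonneg r p k i j
  · exact hM k i j

lemma Nonneg.idCols {β : Type*} {r : ℕ} [NeZero p] {H : Fin p → Matrix (Fin r) β ℝ}
    (hH : Nonneg H) : Nonneg (idCols H) := by
  rintro k i (j | j)
  · exact tId_nonneg r p k i j
  · exact hH k i j

lemma idRows_tprod_tprod_idCols {β γ : Type*} {r s : ℕ} [NeZero p]
    (M : Fin p → Matrix β (Fin r) ℝ) (S : Fin p → Matrix (Fin r) (Fin s) ℝ)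
    (H : Fin p → Matrix (Fin s) γ ℝ) :
    tprod (tprod (idRows M) S) (idCols H) = fun k =>
      Matrix.fromBlocks (S k) (tprod S H k) (tprod M S k) (tprod (tprod M S) H k) := by
  have hl : rsub Sum.inl (idRows M) = tId r p := rfl
  have hr : rsub Sum.inr (idRows M) = M := rfl
  have hl' : csub Sum.inl (idCols H) = tId s p := rfl
  have hr' : csub Sum.inr (idCols H) = H := rfl
  funext k
  ext (i | i) (j | j)
  · have h := coreSub_tprod Sum.inl Sum.inl (tprod (idRows M) S) (idCols H)
    rw [rsub_tprod, hl, hl', tId_tprod, tprod_tId] at h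
    exact congrFun (congrFun (congrFun h k) i) j
  · have h := coreSub_tprod Sum.inl Sum.inr (tprod (idRows M) S) (idCols H)
    rw [rsub_tprod, hl, hr', tId_tprod] at h
    exact congrFun (congrFun (congrFun h k) i) j
  · have h := coreSub_tprod Sum.inr Sum.inl (tprod (idRows M) S) (idCols H)
    rw [rsub_tprod, hr, hl', tprod_tId] at h
    exact congrFun (congrFun (congrFun h k) i) j
  · have h := coreSub_tprod Sum.inr Sum.inr (tprod (idRows M) S) (idCols H)
    rw [rsub_tprod, hr, hr'] at h
    exact congrFun (congrFun (congrFun h k) i) j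

/-- Permuting the rows and columns of the block tensor amounts to a factorization through `S`. -/
lemma coreSub_blockT {m n r1 r2 : ℕ} [NeZero p] (hm : r1 ≤ m) (hn : r2 ≤ n)
    (σ : Fin m → Fin m) (τ : Fin n → Fin n)
    (S : Fin p → Matrix (Fin r1) (Fin r2) ℝ) (M : Fin p → Matrix (Fin (m - r1)) (Fin r1) ℝ)
    (H : Fin p → Matrix (Fin r2) (Fin (n - r2)) ℝ) :
    coreSub σ τ (blockT hm hn S (tprod S H) (tprod M S) (tprod (tprod M S) H)) =
      tprod (tprod (rsub (splitEquiv hm ∘ σ) (idRows M)) S)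
        (csub (splitEquiv hn ∘ τ) (idCols H)) := by
  rw [← rsub_tprod, ← coreSub_tprod, idRows_tprod_tprod_idCols]
  rfl

lemma exists_equiv_sum_extending {m r : ℕ} (ι : Fin r → Fin m) (hι : Function.Injective ι) :
    ∃ f : Fin m ≃ Fin r ⊕ Fin (m - r), ∀ a, f (ι a) = Sum.inl a := by
  classical
  have hcard : Fintype.card ((Set.range ι)ᶜ : Set (Fin m)) = m - r := by
    rw [Fintype.card_compl_set, Set.card_range_of_injective hι, Fintype.card_fin, Fintype.card_fin]
  let g : Fin r ⊕ Fin (m - r) ≃ Fin m :=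
    (Equiv.sumCongr (Equiv.ofInjective ι hι) (Fintype.equivFinOfCardEq hcard).symm).trans
      (Equiv.Set.sumCompl (Set.range ι))
  exact ⟨g.symm, fun a => g.symm_apply_eq.mpr (by simp [g])⟩

lemma rsub_idRows_rsub {m r : ℕ} {β : Type*} [NeZero p] (ι : Fin r → Fin m)
    (f : Fin m ≃ Fin r ⊕ β) (hf : ∀ a, f (ι a) = Sum.inl a)
    (P : Fin p → Matrix (Fin m) (Fin r) ℝ) (hP : rsub ι P = tId r p) :
    rsub f (idRows (rsub (f.symm ∘ Sum.inr) P)) = P := by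
  have h : idRows (rsub (f.symm ∘ Sum.inr) P) = rsub f.symm P := by
    funext k
    ext (i | i) j
    · simp [idRows, rsub, ← hP, (f.symm_apply_eq.mpr (hf i).symm)]
    · rfl
  rw [h]
  funext k
  ext i j
  simp [rsub]

lemma csub_idCols_csub {n r : ℕ} {β : Type*} [NeZero p] (κ : Fin r → Fin n)
    (g : Fin n ≃ Fin r ⊕ β) (hg : ∀ a, g (κ a) = Sum.inl a)
    (P : Fin p → Matrix (Fin r) (Fin n) ℝ) (hP : csub κ P = tId r p) :
    csub g (idCols (csub (g.symm ∘ Sum.inr) P)) = P := by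
  have h : idCols (csub (g.symm ∘ Sum.inr) P) = csub g.symm P := by
    funext k
    ext i (j | j)
    · simp [idCols, csub, ← hP, (g.symm_apply_eq.mpr (hg j).symm)]
    · rfl
  rw [h]
  funext k
  ext i j
  simp [csub]

/-- Proposition 3.2, (i) ⇔ (ii): a nonnegative tensor `A ∈ ℝ_+^{m×n×p}`
is co-(r1,r2)-separable iff it can be written as
`A = Pi1 * [[S, S*H],[M*S, M*S*H]] * Pi2` for permutation tensors `Pi1, Pi2` and
nonnegative tensors `S, M, H`. -/
theorem coseparable_iff_block_form {m n p r1 r2 : ℕ} [NeZero p]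
    (A : Fin p → Matrix (Fin m) (Fin n) ℝ) (hA : Nonneg A)
    (hr1 : 1 ≤ r1) (hr1m : r1 ≤ m) (hr2 : 1 ≤ r2) (hr2n : r2 ≤ n) :
    Coseparable r1 r2 A ↔
      ∃ (Pi1 : Fin p → Matrix (Fin m) (Fin m) ℝ) (Pi2 : Fin p → Matrix (Fin n) (Fin n) ℝ)
        (S : Fin p → Matrix (Fin r1) (Fin r2) ℝ)
        (M : Fin p → Matrix (Fin (m - r1)) (Fin r1) ℝ)
        (H : Fin p → Matrix (Fin r2) (Fin (n - r2)) ℝ),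
        IsPermTensor Pi1 ∧ IsPermTensor Pi2 ∧ Nonneg S ∧ Nonneg M ∧ Nonneg H ∧
        A = tprod (tprod Pi1
          (blockT hr1m hr2n S (tprod S H) (tprod M S) (tprod (tprod M S) H))) Pi2 := by
  constructor
  · rintro ⟨ι, κ, hι, hκ, P1, P2, hP1, hP2, hIP1, hIP2, hfac⟩
    obtain ⟨f, hf⟩ := exists_equiv_sum_extending ι hι
    obtain ⟨g, hg⟩ := exists_equiv_sum_extending κ hκ
    refine ⟨permT p (f.trans (splitEquiv hr1m).symm), permT p (g.trans (splitEquiv hr2n).symm).symm,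
      coreSub ι κ A, rsub (f.symm ∘ Sum.inr) P1, csub (g.symm ∘ Sum.inr) P2,
      isPermTensor_permT _, isPermTensor_permT _, fun _ _ _ => hA _ _ _,
      fun _ _ _ => hP1 _ _ _, fun _ _ _ => hP2 _ _ _, ?_⟩
    have hf' : splitEquiv hr1m ∘ (f.trans (splitEquiv hr1m).symm) = f := by
      funext i; simp
    have hg' : splitEquiv hr2n ∘ (g.trans (splitEquiv hr2n).symm) = g := by
      funext i; simp
    rw [permT_tprod_tprod_permT, Equiv.symm_symm, coreSub_blockT, hf', hg',
      rsub_idRows_rsub ι f hf P1 hIP1, csub_idCols_csub κ g hg P2 hIP2]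
    exact hfac
  · rintro ⟨Pi1, Pi2, S, M, H, hPi1, hPi2, hS, hM, hH, hfac⟩
    obtain ⟨σ, rfl⟩ := hPi1.exists_eq_permT
    obtain ⟨τ, rfl⟩ := hPi2.exists_eq_permT
    rw [permT_tprod_tprod_permT, coreSub_blockT] at hfac
    let f := σ.trans (splitEquiv hr1m)
    let g := τ.symm.trans (splitEquiv hr2n)
    have hrow : rsub (f.symm ∘ Sum.inl) (rsub f (idRows M)) = tId r1 p := by
      funext k
      ext i j
      simp [rsub, idRows]
    have hcol : csub (g.symm ∘ Sum.inl) (csub g (idCols H)) = tId r2 p := by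
      funext k
      ext i j
      simp [csub, idCols]
    have hcore : coreSub (f.symm ∘ Sum.inl) (g.symm ∘ Sum.inl) A = S := by
      rw [hfac, coreSub_tprod, rsub_tprod]
      change tprod (tprod (rsub (f.symm ∘ Sum.inl) (rsub f (idRows M))) S)
        (csub (g.symm ∘ Sum.inl) (csub g (idCols H))) = S
      rw [hrow, hcol, tId_tprod, tprod_tId]
    refine ⟨f.symm ∘ Sum.inl, g.symm ∘ Sum.inl, f.symm.injective.comp Sum.inl_injective,
      g.symm.injective.comp Sum.inl_injective, rsub f (idRows M), csub g (idCols H),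
      fun _ _ _ => hM.idRows _ _ _, fun _ _ _ => hH.idCols _ _ _, hrow, hcol, ?_⟩
    rw [hcore]
    exact hfac

end

end CoSepNTF
end

section
/- Let D_r ∈ ℝ_+^{m×m×p} and D_c ∈ ℝ_+^{n×n×p} be f-diagonal tensors whose first frontal slices are diagonal matrices with strictly positive diagonal entries and whose remaining frontal slices are zero. Then a nonnegative tensor A ∈ ℝ_+^{m×n×p} is co-(r1,r2)-separable if and only if A^scale := D_r * A * D_c is co-(r1,r2)-separable. -/
open Matrix BigOperators Kronecker

namespace CoSepNTF

noncomputable section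

variable {p : ℕ}

/-- The tensor obtained from `A` by multiplying row `i` by `d i` and column `j` by `e j` in every
frontal slice. -/
def scaleT {α β : Type*} (d : α → ℝ) (e : β → ℝ) (A : Fin p → Matrix α β ℝ) :
    Fin p → Matrix α β ℝ :=
  fun k => Matrix.of fun i j => d i * A k i j * e j

lemma scaleT_apply {α β : Type*} (d : α → ℝ) (e : β → ℝ) (A : Fin p → Matrix α β ℝ)
    (k : Fin p) (i : α) (j : β) : scaleT d e A k i j = d i * A k i j * e j := rfl

lemma tprod_apply {α β γ : Type*} [Fintype β] (A : Fin p → Matrix α β ℝ)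
    (B : Fin p → Matrix β γ ℝ) (k : Fin p) (i : α) (j : γ) :
    tprod A B k i j = ∑ t, ∑ b, A (k - t) i b * B t b j := by
  simp [tprod, Matrix.sum_apply, Matrix.mul_apply]

lemma tprod_scaleT {α β γ : Type*} [Fintype β] (d : α → ℝ) (f : β → ℝ) (e : γ → ℝ)
    (hf : ∀ b, f b ≠ 0) (A : Fin p → Matrix α β ℝ) (B : Fin p → Matrix β γ ℝ) :
    tprod (scaleT d f⁻¹ A) (scaleT f e B) = scaleT d e (tprod A B) := by
  ext k i j
  simp only [tprod_apply, scaleT_apply, Finset.mul_sum, Finset.sum_mul, Pi.inv_apply]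
  refine Finset.sum_congr rfl fun t _ => Finset.sum_congr rfl fun b _ => ?_
  have := hf b
  field_simp

lemma scaleT_inv_scaleT {α β : Type*} (d : α → ℝ) (e : β → ℝ) (hd : ∀ i, d i ≠ 0)
    (he : ∀ j, e j ≠ 0) (A : Fin p → Matrix α β ℝ) : scaleT d⁻¹ e⁻¹ (scaleT d e A) = A := by
  ext k i j
  have := hd i
  have := he j
  simp only [scaleT_apply, Pi.inv_apply]
  field_simp

lemma Nonneg.scaleT {α β : Type*} {d : α → ℝ} {e : β → ℝ} {A : Fin p → Matrix α β ℝ}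
    (hA : Nonneg A) (hd : ∀ i, 0 ≤ d i) (he : ∀ j, 0 ≤ e j) : Nonneg (scaleT d e A) :=
  fun k i j => mul_nonneg (mul_nonneg (hd i) (hA k i j)) (he j)

lemma scaleT_inv_tId {r : ℕ} [NeZero p] (d : Fin r → ℝ) (hd : ∀ i, d i ≠ 0) :
    scaleT d d⁻¹ (tId r p) = tId r p := by
  ext k i j
  simp only [scaleT_apply, tId, Pi.inv_apply]
  split_ifs
  · rcases eq_or_ne i j with rfl | h
    · simp [hd i]
    · simp [h]
  · simp

lemma tprod_diagonal_left {α β : Type*} [Fintype α] [DecidableEq α] [NeZero p] (d : α → ℝ)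
    (D : Fin p → Matrix α α ℝ) (hD0 : D 0 = Matrix.diagonal d) (hD : ∀ k, k ≠ 0 → D k = 0)
    (A : Fin p → Matrix α β ℝ) : tprod D A = scaleT d 1 A := by
  ext k i j
  rw [tprod, Finset.sum_eq_single k (fun t _ ht => by
    rw [hD _ (sub_ne_zero.mpr ht.symm), Matrix.zero_mul]) (by simp)]
  simp [hD0, scaleT_apply]

lemma tprod_diagonal_right {α β : Type*} [Fintype β] [DecidableEq β] [NeZero p] (e : β → ℝ)
    (D : Fin p → Matrix β β ℝ) (hD0 : D 0 = Matrix.diagonal e) (hD : ∀ k, k ≠ 0 → D k = 0)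
    (A : Fin p → Matrix α β ℝ) : tprod A D = scaleT 1 e A := by
  ext k i j
  rw [tprod, Finset.sum_eq_single 0 (fun t _ ht => by rw [hD t ht, Matrix.mul_zero]) (by simp)]
  simp [hD0, scaleT_apply]

lemma Coseparable.scaleT {m n r1 r2 : ℕ} [NeZero p] {A : Fin p → Matrix (Fin m) (Fin n) ℝ}
    (hA : Coseparable r1 r2 A) {d : Fin m → ℝ} {e : Fin n → ℝ} (hd : ∀ i, 0 < d i)
    (he : ∀ j, 0 < e j) : Coseparable r1 r2 (scaleT d e A) := by
  obtain ⟨ι, κ, hι, hκ, P1, P2, hP1, hP2, hI, hJ, hA⟩ := hA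
  refine ⟨ι, κ, hι, hκ, CoSepNTF.scaleT d (d ∘ ι)⁻¹ P1, CoSepNTF.scaleT (e ∘ κ)⁻¹ e P2,
    hP1.scaleT (fun i => (hd i).le) (fun a => (inv_pos.mpr (hd (ι a))).le),
    hP2.scaleT (fun b => (inv_pos.mpr (he (κ b))).le) (fun j => (he j).le), ?_, ?_, ?_⟩
  · change CoSepNTF.scaleT (d ∘ ι) (d ∘ ι)⁻¹ (rsub ι P1) = _
    rw [hI, scaleT_inv_tId (d ∘ ι) fun a => (hd (ι a)).ne']
  · change CoSepNTF.scaleT (e ∘ κ)⁻¹ (e ∘ κ) (csub κ P2) = _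
    have := scaleT_inv_tId (p := p) (e ∘ κ)⁻¹ fun b => (inv_pos.mpr (he (κ b))).ne'
    rw [inv_inv] at this
    rw [hJ, this]
  · change _ = tprod (tprod _ (CoSepNTF.scaleT (d ∘ ι) (e ∘ κ) (coreSub ι κ A))) _
    have h := tprod_scaleT d (e ∘ κ)⁻¹ e (fun b => (inv_pos.mpr (he (κ b))).ne')
      (tprod P1 (coreSub ι κ A)) P2
    rw [inv_inv] at h
    rw [tprod_scaleT d (d ∘ ι) (e ∘ κ) fun a => (hd (ι a)).ne', h, ← hA]

/-- Scaling theorem: for f-diagonal scaling tensors `Dr, Dc` whose first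
frontal slices are diagonal with strictly positive diagonal entries and whose other frontal
slices vanish, a nonnegative tensor `A` is co-(r1,r2)-separable iff
`A^scale = Dr * A * Dc` is co-(r1,r2)-separable. -/
theorem coseparable_scale_iff {m n p r1 r2 : ℕ} [NeZero p]
    (A : Fin p → Matrix (Fin m) (Fin n) ℝ) (hA : Nonneg A)
    (dr : Fin m → ℝ) (dc : Fin n → ℝ) (hdr : ∀ i, 0 < dr i) (hdc : ∀ j, 0 < dc j)
    (Dr : Fin p → Matrix (Fin m) (Fin m) ℝ) (Dc : Fin p → Matrix (Fin n) (Fin n) ℝ)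
    (hDr0 : Dr 0 = Matrix.diagonal dr) (hDrk : ∀ k, k ≠ 0 → Dr k = 0)
    (hDc0 : Dc 0 = Matrix.diagonal dc) (hDck : ∀ k, k ≠ 0 → Dc k = 0) :
    Coseparable r1 r2 A ↔ Coseparable r1 r2 (tprod (tprod Dr A) Dc) := by
  have hscale : tprod (tprod Dr A) Dc = scaleT dr dc A := by
    rw [tprod_diagonal_left dr Dr hDr0 hDrk, tprod_diagonal_right dc Dc hDc0 hDck]
    ext k i j
    simp [scaleT_apply]
  rw [hscale]
  refine ⟨fun h => h.scaleT hdr hdc, fun h => ?_⟩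
  rw [← scaleT_inv_scaleT dr dc (fun i => (hdr i).ne') (fun j => (hdc j).ne') A]
  exact h.scaleT (fun i => inv_pos.mpr (hdr i)) (fun j => inv_pos.mpr (hdc j))

end

end CoSepNTF
end

section
/- Let A ∈ ℝ^{m×n×p} and let F_p = (1/√p)(ω_p^{(j−1)(k−1)})_{j,k=1}^p with ω_p = e^{−2πi/p} be the unitary discrete Fourier transform matrix. Then the matrix (F_p ⊗ I_m) · bcirc(A) · (F_p^* ⊗ I_n) is block diagonal: writing it as a p×p array of m×n blocks, its (k,k) diagonal block equals Â_{::k} = Σ_{j=1}^p ω_p^{(j−1)(k−1)} A_{::j} for each k ∈ {1,…,p}, and all off-diagonal blocks are zero. Here ⊗ denotes the Kronecker product and F_p^* the conjugate transpose of F_p. -/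
open Matrix BigOperators Kronecker

namespace CoSepNTF

noncomputable section

variable {p : ℕ}

/-- The root of unity `ω_p = exp(-2πi/p)` is primitive of order `p`. -/
theorem isPrimitiveRoot_exp_neg (p : ℕ) (hp : p ≠ 0) :
    IsPrimitiveRoot (Complex.exp (-2 * (Real.pi : ℂ) * Complex.I / (p : ℂ))) p := by
  have h := (Complex.isPrimitiveRoot_exp p hp).inv
  rw [← Complex.exp_neg] at h
  rwa [show -2 * (Real.pi : ℂ) * Complex.I / (p : ℂ) = -(2 * Real.pi * Complex.I / p) by ring]

/-- The sum over `s` of `(ζ ^ k * conj (ζ ^ l)) ^ s` is `p` if `k = l` and vanishes otherwise,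
for `ζ` a primitive `p`-th root of unity. -/
theorem sum_pow_mul_star_pow {p : ℕ} {ζ : ℂ} (hζ : IsPrimitiveRoot ζ p) (k l : Fin p) :
    ∑ s : Fin p, ζ ^ ((k : ℕ) * (s : ℕ)) * star (ζ ^ ((l : ℕ) * (s : ℕ))) =
      if k = l then (p : ℂ) else 0 := by
  have hp : p ≠ 0 := k.pos.ne'
  have hζ0 : ζ ≠ 0 := hζ.ne_zero hp
  have hstar : star ζ = ζ⁻¹ := by
    rw [Complex.inv_eq_conj (hζ.norm'_eq_one hp)]
    rfl
  have hterm (s : Fin p) : ζ ^ ((k : ℕ) * (s : ℕ)) * star (ζ ^ ((l : ℕ) * (s : ℕ))) =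
      (ζ ^ (k : ℕ) * (ζ ^ (l : ℕ))⁻¹) ^ (s : ℕ) := by
    rw [star_pow, hstar, mul_pow, pow_mul, inv_pow, inv_pow, pow_mul]
  simp_rw [hterm]
  rw [Fin.sum_univ_eq_sum_range (fun s => (ζ ^ (k : ℕ) * (ζ ^ (l : ℕ))⁻¹) ^ s) p]
  split_ifs with hkl
  · subst hkl
    simp [hζ0]
  · have hne : ζ ^ (k : ℕ) * (ζ ^ (l : ℕ))⁻¹ ≠ 1 := by
      intro h
      rw [mul_inv_eq_one₀ (pow_ne_zero _ hζ0)] at h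
      exact hkl (Fin.ext (hζ.pow_inj k.isLt l.isLt h))
    have hone : (ζ ^ (k : ℕ) * (ζ ^ (l : ℕ))⁻¹) ^ p = 1 := by
      rw [mul_pow, inv_pow, pow_right_comm, pow_right_comm ζ (l : ℕ), hζ.pow_eq_one]
      simp
    rw [geom_sum_eq hne, hone, sub_self, zero_div]

/-- The discrete Fourier transform matrix is unitary. -/
theorem dftMatrix_mul_conjTranspose (p : ℕ) : dftMatrix p * (dftMatrix p)ᴴ = 1 := by
  ext k l
  have hp : p ≠ 0 := k.pos.ne'
  have hsqrt : (((Real.sqrt p)⁻¹ : ℝ) : ℂ) * (((Real.sqrt p)⁻¹ : ℝ) : ℂ) = (p : ℂ)⁻¹ := by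
    rw [← Complex.ofReal_mul, ← mul_inv, Real.mul_self_sqrt (Nat.cast_nonneg p)]
    simp
  have hterm (s : Fin p) : dftMatrix p k s * (dftMatrix p)ᴴ s l = (p : ℂ)⁻¹ *
      (Complex.exp (-2 * (Real.pi : ℂ) * Complex.I / (p : ℂ)) ^ ((k : ℕ) * (s : ℕ)) *
        star (Complex.exp (-2 * (Real.pi : ℂ) * Complex.I / (p : ℂ)) ^ ((l : ℕ) * (s : ℕ)))) := by
    rw [conjTranspose_apply, dftMatrix, of_apply, of_apply, star_mul', ← hsqrt]
    rw [show star (((Real.sqrt p)⁻¹ : ℝ) : ℂ) = (((Real.sqrt p)⁻¹ : ℝ) : ℂ) from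
      Complex.conj_ofReal _]
    ring
  rw [mul_apply, Finset.sum_congr rfl fun s _ => hterm s, ← Finset.mul_sum,
    sum_pow_mul_star_pow (isPrimitiveRoot_exp_neg p hp), one_apply]
  split_ifs <;> simp [hp]

/-- Each row of the discrete Fourier transform matrix is multiplicative up to normalization. -/
theorem dftMatrix_add {p : ℕ} (k u t : Fin p) :
    dftMatrix p k (u + t) =
      Complex.exp (-2 * (Real.pi : ℂ) * Complex.I / (p : ℂ)) ^ ((u : ℕ) * (k : ℕ)) *
        dftMatrix p k t := by
  have hζ := isPrimitiveRoot_exp_neg p k.pos.ne'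
  simp only [dftMatrix, of_apply]
  rw [mul_left_comm, mul_comm (u : ℕ), ← pow_add, ← mul_add, mul_comm (k : ℕ),
    mul_comm (k : ℕ), pow_mul, pow_mul, Fin.val_add, ← pow_eq_pow_mod _ hζ.pow_eq_one]

/-- The Fourier transform intertwines the block circulant matrix of a tensor with the block
diagonal matrix of its transformed slices. -/
theorem dftMatrix_kronecker_mul_bcirc {α β : Type*} [Fintype α] [DecidableEq α] [Fintype β]
    [DecidableEq β] {p : ℕ} (A : Fin p → Matrix α β ℝ) :
    (dftMatrix p ⊗ₖ (1 : Matrix α α ℂ)) * (bcirc A).map Complex.ofReal =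
      fftBD A * (dftMatrix p ⊗ₖ (1 : Matrix β β ℂ)) := by
  ext ⟨k, i⟩ ⟨t, j⟩
  have : NeZero p := ⟨k.pos.ne'⟩
  have hl : ((dftMatrix p ⊗ₖ (1 : Matrix α α ℂ)) * (bcirc A).map Complex.ofReal) (k, i) (t, j) =
      ∑ s, dftMatrix p k s * (A (s - t) i j : ℂ) := by
    simp [mul_apply, Fintype.sum_prod_type, one_apply, bcirc]
  have hr : (fftBD A * (dftMatrix p ⊗ₖ (1 : Matrix β β ℂ))) (k, i) (t, j) =
      fft A k i j * dftMatrix p k t := by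
    simp [mul_apply, Fintype.sum_prod_type, one_apply, fftBD]
  rw [hl, hr, ← Equiv.sum_comp (Equiv.addRight t)]
  simp only [Equiv.coe_addRight, add_sub_cancel_right, dftMatrix_add, fft, Matrix.sum_apply,
    Matrix.smul_apply, map_apply, smul_eq_mul, Finset.sum_mul]
  exact Finset.sum_congr rfl fun u _ => by ring

/-- equation (2.4): conjugating the block circulant matrix of `A` by
`F_p ⊗ I` block-diagonalizes it, with `k`-th diagonal block `Â_{::k}`:
`(F_p ⊗ I_m) ⬝ bcirc(A) ⬝ (F_p^* ⊗ I_n) = diag(Â_{::1}, …, Â_{::p})`. -/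
theorem bcirc_block_diagonalization {m n p : ℕ} (A : Fin p → Matrix (Fin m) (Fin n) ℝ) :
    (dftMatrix p ⊗ₖ (1 : Matrix (Fin m) (Fin m) ℂ)) * (bcirc A).map Complex.ofReal *
        ((dftMatrix p)ᴴ ⊗ₖ (1 : Matrix (Fin n) (Fin n) ℂ)) = fftBD A := by
  rw [dftMatrix_kronecker_mul_bcirc, Matrix.mul_assoc, ← mul_kronecker_mul,
    dftMatrix_mul_conjTranspose, Matrix.one_mul, one_kronecker_one, Matrix.mul_one]

end

end CoSepNTF
end

section
/- For all third-order tensors A ∈ ℝ^{m×n×p} and B ∈ ℝ^{n×q×p}, the block circulant of the t-product equals the product of the block circulants: bcirc(A * B) = bcirc(A) · bcirc(B). -/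
open Matrix BigOperators Kronecker

namespace CoSepNTF

noncomputable section

variable {p : ℕ}

/-- `bcirc(A * B) = bcirc(A) ⬝ bcirc(B)`. -/
theorem bcirc_tprod {m n q p : ℕ} (A : Fin p → Matrix (Fin m) (Fin n) ℝ)
    (B : Fin p → Matrix (Fin n) (Fin q) ℝ) :
    bcirc (tprod A B) = bcirc A * bcirc B := by
  rcases Nat.eq_zero_or_pos p with rfl | hp
  · ext ⟨s, _⟩
    exact s.elim0
  have : NeZero p := ⟨hp.ne'⟩
  ext ⟨s, i⟩ ⟨t, j⟩
  simp only [bcirc, tprod, Matrix.of_apply, Matrix.mul_apply, Matrix.sum_apply,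
    Fintype.sum_prod_type]
  refine Fintype.sum_equiv (Equiv.addRight t) _ _ fun u => ?_
  simp only [Equiv.coe_addRight, add_sub_cancel_right, sub_sub, add_comm t u]

end

end CoSepNTF
end

section
/- Let A ∈ ℝ^{m×n×p} admit a t-SVD A = W * Σ * Vᵀ, where W ∈ ℝ^{m×m×p} and V ∈ ℝ^{n×n×p} are orthogonal tensors (Wᵀ*W = W*Wᵀ = I_m and Vᵀ*V = V*Vᵀ = I_n) and Σ ∈ ℝ^{m×n×p} is f-diagonal, and suppose Σ_{jj:} = 0 for every j > r (so the tubal rank of A is at most r). Then for every horizontal index i ∈ {1,…,m}, ‖A_{i::}‖_F² ≤ ‖A‖₂² · ‖W_{i,1:r,:}‖_F²; consequently (1/r)·‖W_{i,1:r,:}‖_F² ≥ (s/r)·‖A_{i::}‖_F²/‖A‖_F² where s = ‖A‖_F²/‖A‖₂² is the stable rank of A (assuming A ≠ 0). -/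
open Matrix BigOperators Kronecker

namespace CoSepNTF

noncomputable section

variable {p : ℕ}

/-- The root of unity `ω_p = exp(-2πi/p)` used in the discrete Fourier transform. -/
def fftRoot (p : ℕ) : ℂ := Complex.exp (-2 * (Real.pi : ℂ) * Complex.I / (p : ℂ))

theorem fft_apply {α β : Type*} (A : Fin p → Matrix α β ℝ) (k : Fin p) (a : α) (b : β) :
    fft A k a b = ∑ j : Fin p, fftRoot p ^ ((j : ℕ) * (k : ℕ)) * (A j a b : ℂ) := by
  simp [fft, fftRoot, Matrix.sum_apply]

theorem isPrimitiveRoot_fftRoot (p : ℕ) [NeZero p] : IsPrimitiveRoot (fftRoot p) p := by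
  have h : fftRoot p = (Complex.exp (2 * Real.pi * Complex.I / p))⁻¹ := by
    rw [fftRoot, ← Complex.exp_neg]
    ring_nf
  rw [h]
  exact (Complex.isPrimitiveRoot_exp p (NeZero.ne p)).inv

theorem fftRoot_pow_add [NeZero p] (s t k : Fin p) :
    fftRoot p ^ (((s + t : Fin p) : ℕ) * (k : ℕ)) =
      fftRoot p ^ ((s : ℕ) * (k : ℕ)) * fftRoot p ^ ((t : ℕ) * (k : ℕ)) := by
  have h : fftRoot p ^ ((s + t : Fin p) : ℕ) = fftRoot p ^ ((s : ℕ) + (t : ℕ)) := by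
    rw [Fin.val_add, ← pow_mod_orderOf _ ((s : ℕ) + (t : ℕ)),
      ← (isPrimitiveRoot_fftRoot p).eq_orderOf]
  rw [pow_mul, h, ← pow_mul, add_mul, pow_add]

theorem conj_fftRoot_pow [NeZero p] (j k : Fin p) :
    star (fftRoot p ^ ((j : ℕ) * (k : ℕ))) = fftRoot p ^ (((-j : Fin p) : ℕ) * (k : ℕ)) := by
  have hne : fftRoot p ^ ((j : ℕ) * (k : ℕ)) ≠ 0 :=
    pow_ne_zero _ ((isPrimitiveRoot_fftRoot p).ne_zero (NeZero.ne p))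
  have hnorm : ‖fftRoot p ^ ((j : ℕ) * (k : ℕ))‖ = 1 := by
    rw [norm_pow, (isPrimitiveRoot_fftRoot p).norm'_eq_one (NeZero.ne p), one_pow]
  apply mul_left_cancel₀ hne
  rw [← fftRoot_pow_add, add_neg_cancel]
  have := Complex.mul_conj' (fftRoot p ^ ((j : ℕ) * (k : ℕ)))
  rw [hnorm] at this
  simpa using this

theorem sum_fftRoot_pow [NeZero p] (j : Fin p) :
    ∑ k : Fin p, fftRoot p ^ ((j : ℕ) * (k : ℕ)) = if j = 0 then (p : ℂ) else 0 := by
  split_ifs with h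
  · simp [h]
  · have hζ := isPrimitiveRoot_fftRoot p
    have hne : fftRoot p ^ (j : ℕ) ≠ 1 :=
      hζ.pow_ne_one_of_pos_of_lt (by simpa using h) j.isLt
    simp_rw [pow_mul]
    rw [Fin.sum_univ_eq_sum_range (fun k => (fftRoot p ^ (j : ℕ)) ^ k) p, geom_sum_eq hne,
      ← pow_mul, mul_comm, pow_mul, hζ.pow_eq_one]
    simp

/-- The Fourier transform turns the t-product into slicewise products. -/
theorem fft_tprod {α β γ : Type*} [Fintype β] [NeZero p] (A : Fin p → Matrix α β ℝ)
    (B : Fin p → Matrix β γ ℝ) (k : Fin p) : fft (tprod A B) k = fft A k * fft B k := by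
  ext a c
  simp only [fft_apply, Matrix.mul_apply, tprod, Matrix.sum_apply, Complex.ofReal_sum,
    Complex.ofReal_mul, Finset.mul_sum, Finset.sum_mul]
  rw [Finset.sum_comm]
  conv_rhs => rw [Finset.sum_comm]
  refine Finset.sum_congr rfl fun t _ => ?_
  rw [Finset.sum_comm]
  refine Finset.sum_congr rfl fun b _ => ?_
  rw [← Equiv.sum_comp (Equiv.addRight t)]
  refine Finset.sum_congr rfl fun s _ => ?_
  simp only [Equiv.coe_addRight, add_sub_cancel_right, fftRoot_pow_add]
  ring

theorem fft_tT {α β : Type*} [NeZero p] (A : Fin p → Matrix α β ℝ) (k : Fin p) :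
    fft (tT A) k = (fft A k)ᴴ := by
  ext b a
  rw [Matrix.conjTranspose_apply, fft_apply, fft_apply, star_sum,
    ← Equiv.sum_comp (Equiv.neg (Fin p))]
  refine Finset.sum_congr rfl fun j _ => ?_
  rw [star_mul', conj_fftRoot_pow]
  simp [tT]

theorem fft_tId (n p : ℕ) [NeZero p] (k : Fin p) : fft (tId n p) k = 1 := by
  ext a b
  rw [fft_apply, Finset.sum_eq_single 0]
  · simp [tId, Matrix.one_apply, apply_ite]
  · intro j _ hj
    simp [tId, hj]
  · simp

theorem sum_fft {α β : Type*} [NeZero p] (A : Fin p → Matrix α β ℝ) (a : α) (b : β) :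
    ∑ k, fft A k a b = p * (A 0 a b : ℂ) := by
  simp only [fft_apply]
  rw [Finset.sum_comm]
  simp [← Finset.sum_mul, sum_fftRoot_pow]

/-- Parseval's identity for a horizontal slice. -/
theorem sum_norm_fft_row {α β : Type*} [Fintype β] [NeZero p] (A : Fin p → Matrix α β ℝ)
    (a : α) : ∑ k, ∑ b, ‖fft A k a b‖ ^ 2 = p * ∑ k, ∑ b, (A k a b) ^ 2 := by
  have h := sum_fft (tprod A (tT A)) a a
  simp only [fft_tprod, fft_tT, Matrix.mul_apply, Matrix.conjTranspose_apply] at h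
  have h0 : tprod A (tT A) 0 a a = ∑ k, ∑ b, (A k a b) ^ 2 := by
    rw [← Equiv.sum_comp (Equiv.neg (Fin p))]
    simp [tprod, tT, Matrix.sum_apply, Matrix.mul_apply, sq]
  rw [h0] at h
  have h' : ∀ z : ℂ, z * star z = ((‖z‖ ^ 2 : ℝ) : ℂ) := fun z => by
    simpa using Complex.mul_conj' z
  simp only [h'] at h
  exact_mod_cast h

open scoped Matrix.Norms.L2Operator in
/-- If `M = X * Uᴴ * M` with `U` unitary, each row of `M` is bounded by the spectral norm of `M`
times the norm of the corresponding row of `X`. -/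
theorem sum_norm_row_le {α β : Type*} [Fintype α] [Fintype β] [DecidableEq α] [DecidableEq β]
    {M : Matrix α β ℂ} {X U : Matrix α α ℂ} (hU : U * Uᴴ = 1) (hM : M = X * (Uᴴ * M)) (a : α) :
    ∑ b, ‖M a b‖ ^ 2 ≤ specNorm M ^ 2 * ∑ c, ‖X a c‖ ^ 2 := by
  have hspec : specNorm M = ‖M‖ := rfl
  have hmul : ‖Uᴴ * M‖ = ‖M‖ := by
    have h1 := Matrix.l2_opNorm_conjTranspose_mul_self (Uᴴ * M)
    have h2 := Matrix.l2_opNorm_conjTranspose_mul_self M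
    have h3 : (Uᴴ * M)ᴴ * (Uᴴ * M) = Mᴴ * M := by
      rw [Matrix.conjTranspose_mul, Matrix.conjTranspose_conjTranspose, Matrix.mul_assoc,
        ← Matrix.mul_assoc U, hU, Matrix.one_mul]
    rw [h3, h2] at h1
    exact ((mul_self_inj (norm_nonneg _) (norm_nonneg _)).1 h1).symm
  have hle := Matrix.l2_opNorm_mulVec (Uᴴ * M)ᴴ (WithLp.toLp 2 (star (X a)))
  rw [Matrix.l2_opNorm_conjTranspose, hmul, ← hspec] at hle
  have hrow : (Uᴴ * M)ᴴ *ᵥ star (X a) = star (M a) := by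
    rw [← Matrix.star_vecMul]
    congr 1
    conv_rhs => rw [hM]
    rfl
  have hsq := pow_le_pow_left₀ (norm_nonneg _) hle 2
  rw [mul_pow, EuclideanSpace.norm_sq_eq, EuclideanSpace.norm_sq_eq] at hsq
  rw [hrow] at hsq
  simpa using hsq

theorem specNorm_fft_le {α β : Type*} [Fintype α] [Fintype β] [DecidableEq β]
    (A : Fin p → Matrix α β ℝ) (k : Fin p) : specNorm (fft A k) ≤ tSpecNorm A :=
  le_ciSup (f := fun k => specNorm (fft A k)) (Set.finite_range _).bddAbove k

/-- If `A = X * Wᵀ * A` with `W` orthogonal, each horizontal slice of `A` is bounded by the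
tensor spectral norm of `A` times the norm of the corresponding slice of `X`. -/
theorem sum_sq_row_le {m n : ℕ} [NeZero p] {A : Fin p → Matrix (Fin m) (Fin n) ℝ}
    {X W : Fin p → Matrix (Fin m) (Fin m) ℝ} (hW : tprod W (tT W) = tId m p)
    (hA : ∀ k, fft A k = fft X k * ((fft W k)ᴴ * fft A k)) (i : Fin m) :
    ∑ k, ∑ j, (A k i j) ^ 2 ≤ tSpecNorm A ^ 2 * ∑ k, ∑ j, (X k i j) ^ 2 := by
  have hp : (0 : ℝ) < p := Nat.cast_pos.2 (NeZero.pos p)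
  refine le_of_mul_le_mul_left ?_ hp
  rw [mul_left_comm, ← sum_norm_fft_row, ← sum_norm_fft_row, Finset.mul_sum]
  refine Finset.sum_le_sum fun k _ => ?_
  have hU : fft W k * (fft W k)ᴴ = 1 := by rw [← fft_tT, ← fft_tprod, hW, fft_tId]
  refine (sum_norm_row_le hU (hA k) i).trans ?_
  have h0 : 0 ≤ specNorm (fft A k) := norm_nonneg _
  gcongr
  exact specNorm_fft_le A k

/-- leverage score bound: if `A = W * D * Vᵀ` is a t-SVD of `A` with
orthogonal `W, V` and f-diagonal `D` whose diagonal tubes vanish beyond position `r`, then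
for every `i`, `‖A_{i::}‖_F² ≤ ‖A‖₂² ⬝ ‖W_{i,1:r,:}‖_F²`; consequently, if `A ≠ 0`,
`(1/r) ‖W_{i,1:r,:}‖_F² ≥ (s/r) ‖A_{i::}‖_F²/‖A‖_F²` where `s` is the stable rank. -/
theorem leverage_score_bound {m n p r : ℕ} [NeZero p]
    (A : Fin p → Matrix (Fin m) (Fin n) ℝ)
    (W : Fin p → Matrix (Fin m) (Fin m) ℝ) (V : Fin p → Matrix (Fin n) (Fin n) ℝ)
    (D : Fin p → Matrix (Fin m) (Fin n) ℝ)
    (hW : tprod (tT W) W = tId m p ∧ tprod W (tT W) = tId m p)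
    (hV : tprod (tT V) V = tId n p ∧ tprod V (tT V) = tId n p)
    (hfdiag : ∀ k (i : Fin m) (j : Fin n), (i : ℕ) ≠ (j : ℕ) → D k i j = 0)
    (htrunc : ∀ k (i : Fin m) (j : Fin n), (i : ℕ) = (j : ℕ) → r ≤ (j : ℕ) → D k i j = 0)
    (hSVD : A = tprod (tprod W D) (tT V)) :
    ∀ i : Fin m,
      (∑ k, ∑ j, (A k i j) ^ 2) ≤
        (tSpecNorm A) ^ 2 * (∑ k, ∑ j : Fin m, if (j : ℕ) < r then (W k i j) ^ 2 else 0) ∧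
      (A ≠ 0 →
        (frobSq A / (tSpecNorm A) ^ 2) / r * ((∑ k, ∑ j, (A k i j) ^ 2) / frobSq A) ≤
          (1 / r) * (∑ k, ∑ j : Fin m, if (j : ℕ) < r then (W k i j) ^ 2 else 0)) := by
  intro i
  let X : Fin p → Matrix (Fin m) (Fin m) ℝ := fun k => Matrix.of fun a b =>
    if (b : ℕ) < r then W k a b else 0
  have hXD : tprod X D = tprod W D := by
    funext s
    ext a b
    simp only [tprod, Matrix.sum_apply, Matrix.mul_apply]
    refine Finset.sum_congr rfl fun t _ => Finset.sum_congr rfl fun c _ => ?_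
    by_cases hc : (c : ℕ) < r
    · simp [X, hc]
    · have hD : D t c b = 0 := by
        by_cases hcb : (c : ℕ) = b
        · exact htrunc t c b hcb (by omega)
        · exact hfdiag t c b hcb
      simp [hD]
  have hA : ∀ k, fft A k = fft X k * ((fft W k)ᴴ * fft A k) := fun k => by
    have hWk : (fft W k)ᴴ * fft W k = 1 := by rw [← fft_tT, ← fft_tprod, hW.1, fft_tId]
    have hAk : fft A k = fft W k * (fft D k * fft (tT V) k) := by
      rw [hSVD, fft_tprod, fft_tprod, Matrix.mul_assoc]
    rw [hAk, ← Matrix.mul_assoc (fft W k)ᴴ, hWk, Matrix.one_mul, ← Matrix.mul_assoc,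
      ← Matrix.mul_assoc, ← fft_tprod, ← fft_tprod X, hXD]
  have hX : ∀ k, ∀ j : Fin m, X k i j ^ 2 = if (j : ℕ) < r then (W k i j) ^ 2 else 0 :=
    fun k j => by simp [X]
  have hmain := sum_sq_row_le hW.2 hA i
  simp only [hX] at hmain
  refine ⟨hmain, fun _ => ?_⟩
  set S := ∑ k, ∑ j, (A k i j) ^ 2
  set L := ∑ k, ∑ j : Fin m, if (j : ℕ) < r then (W k i j) ^ 2 else 0
  have hL : 0 ≤ L := Finset.sum_nonneg fun k _ => Finset.sum_nonneg fun j _ => by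
    split_ifs <;> positivity
  have hS : 0 ≤ S := by positivity
  have hT : S / tSpecNorm A ^ 2 ≤ L := div_le_of_le_mul₀ (sq_nonneg _) hL (by linarith)
  have hF : frobSq A / frobSq A ≤ 1 := div_self_le_one _
  calc frobSq A / tSpecNorm A ^ 2 / r * (S / frobSq A)
      = frobSq A / frobSq A * (1 / r * (S / tSpecNorm A ^ 2)) := by ring
    _ ≤ 1 * (1 / r * (S / tSpecNorm A ^ 2)) := by gcongr
    _ ≤ 1 / r * L := by rw [one_mul]; gcongr

end

end CoSepNTF
end

section
/- Let A ∈ ℝ_+^{m×n×p} be co-(r1,r2)-separable, witnessed by index sets I, J and nonnegative tensors P1 ∈ ℝ_+^{m×r1×p}, P2 ∈ ℝ_+^{r2×n×p} with A = P1 * A_{IJ:} * P2, and suppose that all frontal slices of P1 and of P2 other than the first are zero. Then unfold(A) = B · (P2)_{::1}, where B is the mp×r2 block-column matrix whose k-th block (k ∈ {1,…,p}) is the matrix product (P1)_{::1} · (A_{IJ:})_{::k}; in particular, unfold(A) is an r2-separable matrix with unfold(A)_{:J} = B (every column of unfold(A) is a nonnegative combination, given by (P2)_{::1}, of its columns indexed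 by J). -/
open Matrix BigOperators Kronecker

namespace CoSepNTF

noncomputable section

variable {p : ℕ}

/-- Left t-product with a tensor supported on its first frontal slice. -/
theorem tprod_of_left_eq_zero {α β γ : Type*} [Fintype β] [NeZero p]
    {A : Fin p → Matrix α β ℝ} (hA : ∀ k, k ≠ 0 → A k = 0) (B : Fin p → Matrix β γ ℝ)
    (s : Fin p) : tprod A B s = A 0 * B s := by
  rw [tprod, Finset.sum_eq_single s]
  · rw [sub_self]
  · intro t _ ht
    rw [hA _ (sub_ne_zero.mpr ht.symm), Matrix.zero_mul]
  · simp

/-- Right t-product with a tensor supported on its first frontal slice. -/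
theorem tprod_of_right_eq_zero {α β γ : Type*} [Fintype β] [NeZero p]
    (A : Fin p → Matrix α β ℝ) {B : Fin p → Matrix β γ ℝ} (hB : ∀ k, k ≠ 0 → B k = 0)
    (s : Fin p) : tprod A B s = A s * B 0 := by
  rw [tprod, Finset.sum_eq_single 0]
  · rw [sub_zero]
  · intro t _ ht
    rw [hB t ht, Matrix.mul_zero]
  · simp

/-- Remark 3.1: if `A = P1 * A_{IJ:} * P2` is a coseparable
factorization in which all frontal slices of `P1` and `P2` other than the first vanish,
then `unfold(A) = B ⬝ (P2)_{::1}` where `B` is the block-column matrix with `k`-th block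
`(P1)_{::1} ⬝ (A_{IJ:})_{::k}`; in particular `unfold(A)` is `r2`-separable with
`unfold(A)_{:J} = B`. -/
theorem unfold_separable_of_first_slice_factors {m n p r1 r2 : ℕ} [NeZero p]
    (A : Fin p → Matrix (Fin m) (Fin n) ℝ) (hA : Nonneg A)
    (ι : Fin r1 → Fin m) (κ : Fin r2 → Fin n)
    (hι : Function.Injective ι) (hκ : Function.Injective κ)
    (P1 : Fin p → Matrix (Fin m) (Fin r1) ℝ) (P2 : Fin p → Matrix (Fin r2) (Fin n) ℝ)
    (hP1 : Nonneg P1) (hP2 : Nonneg P2)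
    (hP1I : rsub ι P1 = tId r1 p) (hP2J : csub κ P2 = tId r2 p)
    (hfac : A = tprod (tprod P1 (coreSub ι κ A)) P2)
    (hP1k : ∀ k, k ≠ 0 → P1 k = 0) (hP2k : ∀ k, k ≠ 0 → P2 k = 0) :
    unfoldT A =
      (Matrix.of fun ki b => (P1 0 * coreSub ι κ A ki.1) ki.2 b :
        Matrix (Fin p × Fin m) (Fin r2) ℝ) * P2 0 ∧
    (unfoldT A).submatrix id κ =
      Matrix.of fun ki b => (P1 0 * coreSub ι κ A ki.1) ki.2 b := by
  have hslice (k : Fin p) : A k = P1 0 * coreSub ι κ A k * P2 0 := by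
    conv_lhs => rw [hfac]
    rw [tprod_of_right_eq_zero _ hP2k, tprod_of_left_eq_zero hP1k]
  have hP2κ : (P2 0).submatrix id κ = 1 := by
    simpa [csub, tId] using congrFun hP2J 0
  refine ⟨?_, ?_⟩
  · ext ⟨k, i⟩ j
    exact congrFun (congrFun (hslice k) i) j
  · ext ⟨k, i⟩ b
    have hcols : (A k).submatrix id κ = P1 0 * coreSub ι κ A k := by
      conv_lhs => rw [hslice k]
      rw [Matrix.submatrix_mul _ _ id id κ Function.bijective_id, hP2κ, Matrix.submatrix_id_id,
        Matrix.mul_one]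
    exact congrFun (congrFun hcols i) b

end

end CoSepNTF
end
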